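/- Suppose Ω^n ⊆ G^n for every n (equivalently G = Ω as complexes, so the co-Gysin complex 𝒦 = Ω/G is zero). Then for every n, the map H^n(Ω) → H^n(C) induced by π' (namely [α] ↦ [(α,0)⊗1]) is an isomorphism. -/

import Mathlib

/-!
Common algebraic model for the paper "Intersection cohomology of circle actions"
(Padilla–Saralegi), following the CONTEXT of the statements.

`A` models the (total space of the) graded-commutative differential graded ℝ-algebra
`A = ⊕ₙ Aⁿ` of liftable forms on the orbit space `B`; the grading is only recorded
through the families of graded subspaces `P Q : ℤ → Submodule ℝ A` (the forms of
perverse degree `≤ p̄` resp. `≤ p̄ - x̄`), which vanish in negative degrees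
(`Aⁿ = 0` for `n < 0`).  The differential is `d` with `d ∘ d = 0`, and
`e : A →ₗ[ℝ] A` is right multiplication by the fixed Euler form `ε ∈ A²`;
the hypotheses `dε = 0` together with the graded Leibniz rule amount exactly to
the commutation `d ∘ e = e ∘ d`, which is how we encode them.
-/

open Submodule LinearMap

noncomputable section

namespace IG

variable {A : Type*} [AddCommGroup A] [Module ℝ A]

/-- `Ω^n = {α ∈ P^n : dα ∈ P^(n+1)}`. -/
def Om (d : A →ₗ[ℝ] A) (P : ℤ → Submodule ℝ A) (n : ℤ) : Submodule ℝ A :=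
  P n ⊓ (P (n + 1)).comap d

/-- First component of `D` in degree `n` : `(α, β) ↦ dα + (-1)^(n-1) β∧ε`. -/
def D1 (d e : A →ₗ[ℝ] A) (n : ℤ) : A × A →ₗ[ℝ] A :=
  d ∘ₗ LinearMap.fst ℝ A A + ((-1 : ℝ) ^ (n - 1)) • (e ∘ₗ LinearMap.snd ℝ A A)

/-- `D(α,β) = (dα + (-1)^(n-1) β∧ε, dβ)` in degree `n`. -/
def Dmap (d e : A →ₗ[ℝ] A) (n : ℤ) : A × A →ₗ[ℝ] A × A :=
  (D1 d e n).prod (d ∘ₗ LinearMap.snd ℝ A A)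

/-- `K^n = {(α,β) ∈ P^n × Q^(n-1) : dβ ∈ Q^n, dα + (-1)^(n-1) β∧ε ∈ P^(n+1)}`. -/
def Ksub (d e : A →ₗ[ℝ] A) (P Q : ℤ → Submodule ℝ A) (n : ℤ) : Submodule ℝ (A × A) :=
  (P n).comap (LinearMap.fst ℝ A A) ⊓ (Q (n - 1)).comap (LinearMap.snd ℝ A A) ⊓
    (Q n).comap (d ∘ₗ LinearMap.snd ℝ A A) ⊓ (P (n + 1)).comap (D1 d e n)

/-- `G^n = {β ∈ Q^n : dβ ∈ Q^(n+1), ∃ α ∈ P^(n+1), dα + (-1)^n β∧ε ∈ P^(n+2)}`. -/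
def Gsub (d e : A →ₗ[ℝ] A) (P Q : ℤ → Submodule ℝ A) (n : ℤ) : Submodule ℝ A :=
  Q n ⊓ (Q (n + 1)).comap d ⊓
    (((P (n + 1)).comap (LinearMap.fst ℝ A A) ⊓
        (P (n + 2)).comap
          (d ∘ₗ LinearMap.fst ℝ A A + ((-1 : ℝ) ^ n) • (e ∘ₗ LinearMap.snd ℝ A A))).map
      (LinearMap.snd ℝ A A))

/-- `C^m = ⊕_{i+2j=m} K^i ⊗ ℝ·u^j`, realized as the functions `ω : ℕ → A × A`
(`ω j` = the coefficient of `u^j`) with `ω j ∈ K^(m-2j)` for all `j`. -/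
def Csub (d e : A →ₗ[ℝ] A) (P Q : ℤ → Submodule ℝ A) (m : ℤ) : Submodule ℝ (ℕ → A × A) :=
  ⨅ j : ℕ, (Ksub d e P Q (m - 2 * (j : ℤ))).comap (LinearMap.proj (R := ℝ) j)

/-- `∇((α,β) ⊗ u^j) = D(α,β) ⊗ u^j + (-1)^(n-1) (β,0) ⊗ u^(j+1)` on total degree `m`. -/
def nabla (d e : A →ₗ[ℝ] A) (m : ℤ) : (ℕ → A × A) →ₗ[ℝ] (ℕ → A × A) :=
  LinearMap.pi fun j : ℕ =>
    Dmap d e (m - 2 * (j : ℤ)) ∘ₗ LinearMap.proj j +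
      if j = 0 then 0
      else ((-1 : ℝ) ^ (m - 2 * ((j : ℤ) - 1) - 1)) •
        (LinearMap.inl ℝ A A ∘ₗ LinearMap.snd ℝ A A ∘ₗ LinearMap.proj (j - 1))

/-- Multiplication by `u` (degree 2) on an `ℝ[u]`-module realized as `ℕ → M`. -/
def shiftL (M : Type*) [AddCommGroup M] [Module ℝ M] : (ℕ → M) →ₗ[ℝ] (ℕ → M) :=
  LinearMap.pi fun j : ℕ => if j = 0 then 0 else LinearMap.proj (j - 1)

/-- `π' (α ⊗ u^j) = (α, 0) ⊗ u^j`. -/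
def piMap : (ℕ → A) →ₗ[ℝ] ℕ → A × A :=
  LinearMap.pi fun j : ℕ => LinearMap.inl ℝ A A ∘ₗ LinearMap.proj j

/-- `∮' ((α,β) ⊗ u^j) = β ⊗ u^j`. -/
def ointMap : (ℕ → A × A) →ₗ[ℝ] ℕ → A :=
  LinearMap.pi fun j : ℕ => LinearMap.snd ℝ A A ∘ₗ LinearMap.proj j

/-- `d ⊗ 1`. -/
def dpi (d : A →ₗ[ℝ] A) : (ℕ → A) →ₗ[ℝ] ℕ → A :=
  LinearMap.pi fun j : ℕ => d ∘ₗ LinearMap.proj j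

/-- `(Ω ⊗ ℝ[u])^m`. -/
def OmC (d : A →ₗ[ℝ] A) (P : ℤ → Submodule ℝ A) (m : ℤ) : Submodule ℝ (ℕ → A) :=
  ⨅ j : ℕ, (Om d P (m - 2 * (j : ℤ))).comap (LinearMap.proj (R := ℝ) j)

/-- `(G[-1] ⊗ ℝ[u])^m` (`G[-1]` places `G^n` in degree `n+1`). -/
def GCs (d e : A →ₗ[ℝ] A) (P Q : ℤ → Submodule ℝ A) (m : ℤ) : Submodule ℝ (ℕ → A) :=
  ⨅ j : ℕ, (Gsub d e P Q (m - 1 - 2 * (j : ℤ))).comap (LinearMap.proj (R := ℝ) j)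

/-- Cohomology presented as (cocycles) / (coboundaries). -/
abbrev Hq {M : Type*} [AddCommGroup M] [Module ℝ M] (Z B : Submodule ℝ M) :=
  Z ⧸ (B.comap Z.subtype)

/-- Cocycles of `Ω`. -/
def ZOm (d : A →ₗ[ℝ] A) (P : ℤ → Submodule ℝ A) (n : ℤ) : Submodule ℝ A :=
  Om d P n ⊓ LinearMap.ker d

/-- Coboundaries of `Ω`. -/
def BOm (d : A →ₗ[ℝ] A) (P : ℤ → Submodule ℝ A) (n : ℤ) : Submodule ℝ A :=
  (Om d P (n - 1)).map d

/-- `H^n(Ω)`. -/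
abbrev HOm (d : A →ₗ[ℝ] A) (P : ℤ → Submodule ℝ A) (n : ℤ) :=
  Hq (ZOm d P n) (BOm d P n)

/-- Cocycles of `G`. -/
def ZG (d e : A →ₗ[ℝ] A) (P Q : ℤ → Submodule ℝ A) (n : ℤ) : Submodule ℝ A :=
  Gsub d e P Q n ⊓ LinearMap.ker d

/-- Coboundaries of `G`. -/
def BG (d e : A →ₗ[ℝ] A) (P Q : ℤ → Submodule ℝ A) (n : ℤ) : Submodule ℝ A :=
  (Gsub d e P Q (n - 1)).map d

/-- `H^n(G)`. -/
abbrev HG (d e : A →ₗ[ℝ] A) (P Q : ℤ → Submodule ℝ A) (n : ℤ) :=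
  Hq (ZG d e P Q n) (BG d e P Q n)

/-- The co-Gysin space `𝒦^n = Ω^n / G^n` (cochain level). -/
abbrev Kq (d e : A →ₗ[ℝ] A) (P Q : ℤ → Submodule ℝ A) (n : ℤ) :=
  (Om d P n) ⧸ ((Gsub d e P Q n).comap (Om d P n).subtype)

/-- Cocycles of the co-Gysin complex `𝒦 = Ω/G`, presented by representatives:
`α ∈ Ω^n` with `dα ∈ G^(n+1)`. -/
def ZKo (d e : A →ₗ[ℝ] A) (P Q : ℤ → Submodule ℝ A) (n : ℤ) : Submodule ℝ A :=
  Om d P n ⊓ (Gsub d e P Q (n + 1)).comap d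

/-- Representatives of coboundaries of `𝒦 = Ω/G`. -/
def BKo (d e : A →ₗ[ℝ] A) (P Q : ℤ → Submodule ℝ A) (n : ℤ) : Submodule ℝ A :=
  Gsub d e P Q n ⊔ (Om d P (n - 1)).map d

/-- `H^n(𝒦)`. -/
abbrev HKo (d e : A →ₗ[ℝ] A) (P Q : ℤ → Submodule ℝ A) (n : ℤ) :=
  Hq (ZKo d e P Q n) (BKo d e P Q n)

/-- Cocycles of `(C, ∇)`. -/
def ZC (d e : A →ₗ[ℝ] A) (P Q : ℤ → Submodule ℝ A) (m : ℤ) : Submodule ℝ (ℕ → A × A) :=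
  Csub d e P Q m ⊓ LinearMap.ker (nabla d e m)

/-- Coboundaries of `(C, ∇)`. -/
def BC (d e : A →ₗ[ℝ] A) (P Q : ℤ → Submodule ℝ A) (m : ℤ) : Submodule ℝ (ℕ → A × A) :=
  (Csub d e P Q (m - 1)).map (nabla d e (m - 1))

/-- `H^m(C)`, the equivariant intersection cohomology. -/
abbrev HC (d e : A →ₗ[ℝ] A) (P Q : ℤ → Submodule ℝ A) (m : ℤ) :=
  Hq (ZC d e P Q m) (BC d e P Q m)

/-- Cocycles of `(Ω ⊗ ℝ[u], d ⊗ 1)`. -/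
def ZOmC (d : A →ₗ[ℝ] A) (P : ℤ → Submodule ℝ A) (m : ℤ) : Submodule ℝ (ℕ → A) :=
  OmC d P m ⊓ LinearMap.ker (dpi d)

/-- Coboundaries of `(Ω ⊗ ℝ[u], d ⊗ 1)`. -/
def BOmC (d : A →ₗ[ℝ] A) (P : ℤ → Submodule ℝ A) (m : ℤ) : Submodule ℝ (ℕ → A) :=
  (OmC d P (m - 1)).map (dpi d)

/-- `[H(Ω) ⊗ ℝ[u]]^m`, as the cohomology of the complex `(Ω ⊗ ℝ[u], d ⊗ 1)`. -/
abbrev HOmCq (d : A →ₗ[ℝ] A) (P : ℤ → Submodule ℝ A) (m : ℤ) :=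
  Hq (ZOmC d P m) (BOmC d P m)

/-- Cocycles of `(G[-1] ⊗ ℝ[u], d ⊗ 1)`. -/
def ZGC (d e : A →ₗ[ℝ] A) (P Q : ℤ → Submodule ℝ A) (m : ℤ) : Submodule ℝ (ℕ → A) :=
  GCs d e P Q m ⊓ LinearMap.ker (dpi d)

/-- Coboundaries of `(G[-1] ⊗ ℝ[u], d ⊗ 1)`. -/
def BGC (d e : A →ₗ[ℝ] A) (P Q : ℤ → Submodule ℝ A) (m : ℤ) : Submodule ℝ (ℕ → A) :=
  (GCs d e P Q (m - 1)).map (dpi d)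

/-- `[H(G) ⊗ ℝ[u]]^(m-1)`, as the cohomology of `(G[-1] ⊗ ℝ[u], d ⊗ 1)` in degree `m`. -/
abbrev HGCq (d e : A →ₗ[ℝ] A) (P Q : ℤ → Submodule ℝ A) (m : ℤ) :=
  Hq (ZGC d e P Q m) (BGC d e P Q m)

/-- The subspace of `ω : ℕ → A × A` supported in (filtration) degrees `≥ i`
(for total degree `m`): `ω j = 0` whenever `m - 2j < i`. -/
def Supp (i m : ℤ) : Submodule ℝ (ℕ → A × A) :=
  ⨅ (j : ℕ) (_ : m - 2 * (j : ℤ) < i),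
    LinearMap.ker (LinearMap.proj (R := ℝ) (φ := fun _ : ℕ => A × A) j)

/-- The filtration `F^i C^m = {ω ∈ ⊕_{i'≥i} K^{i'} ⊗ ℝ[u] of total degree m :
∇ω ∈ ⊕_{i'≥i} K^{i'} ⊗ ℝ[u]}`. -/
def FC (d e : A →ₗ[ℝ] A) (P Q : ℤ → Submodule ℝ A) (i m : ℤ) : Submodule ℝ (ℕ → A × A) :=
  Csub d e P Q m ⊓ Supp i m ⊓ (Supp i (m + 1)).comap (nabla d e m)

/-- `Z_r^{i,j} = F^i C^(i+j) ∩ ∇⁻¹(F^(i+r) C^(i+j+1))`. -/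
def Zsp (d e : A →ₗ[ℝ] A) (P Q : ℤ → Submodule ℝ A) (r i j : ℤ) : Submodule ℝ (ℕ → A × A) :=
  FC d e P Q i (i + j) ⊓ (FC d e P Q (i + r) (i + j + 1)).comap (nabla d e (i + j))

/-- `B_r^{i,j} = F^i C^(i+j) ∩ ∇(F^(i-r) C^(i+j-1))`. -/
def Bsp (d e : A →ₗ[ℝ] A) (P Q : ℤ → Submodule ℝ A) (r i j : ℤ) : Submodule ℝ (ℕ → A × A) :=
  FC d e P Q i (i + j) ⊓ (FC d e P Q (i - r) (i + j - 1)).map (nabla d e (i + j - 1))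

/-- `E_r^{i,j} = Z_r^{i,j} / (Z_(r-1)^{i+1,j-1} + B_(r-1)^{i,j})`. -/
abbrev Esp (d e : A →ₗ[ℝ] A) (P Q : ℤ → Submodule ℝ A) (r i j : ℤ) :=
  Zsp d e P Q r i j ⧸
    ((Zsp d e P Q (r - 1) (i + 1) (j - 1) ⊔ Bsp d e P Q (r - 1) i j).comap
      (Zsp d e P Q r i j).subtype)

/-- The differential `d_r : E_r^{i,j} → E_r^{i+r,j-r+1}` is the map induced by `∇`
(the target indices `(i', j')` are given freely, to be instantiated by
expressions equal to `(i + r, j - r + 1)`). -/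
def DrChar (d e : A →ₗ[ℝ] A) (P Q : ℤ → Submodule ℝ A) (r i j i' j' : ℤ)
    (dr : Esp d e P Q r i j →ₗ[ℝ] Esp d e P Q r i' j') : Prop :=
  ∀ (ω : ℕ → A × A) (hω : ω ∈ Zsp d e P Q r i j)
    (hω' : nabla d e (i + j) ω ∈ Zsp d e P Q r i' j'),
    dr (Submodule.Quotient.mk ⟨ω, hω⟩) = Submodule.Quotient.mk ⟨nabla d e (i + j) ω, hω'⟩

/-- `α ↦ (α, 0) ⊗ u^0 = (α,0) ⊗ 1`. -/
def embL : A →ₗ[ℝ] ℕ → A × A :=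
  LinearMap.single ℝ (fun _ : ℕ => A × A) 0 ∘ₗ LinearMap.inl ℝ A A

/-- `ι̃ : H^n(G) → H^{n'}(Ω)` induced by the inclusion `G ⊆ Ω` (`n' = n`). -/
def iotaChar (d e : A →ₗ[ℝ] A) (P Q : ℤ → Submodule ℝ A) (n n' : ℤ)
    (ι : HG d e P Q n →ₗ[ℝ] HOm d P n') : Prop :=
  ∀ (β : A) (hβ : β ∈ ZG d e P Q n) (hβ' : β ∈ ZOm d P n'),
    ι (Submodule.Quotient.mk ⟨β, hβ⟩) = Submodule.Quotient.mk ⟨β, hβ'⟩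

/-- `𝕖 : H^n(G) → H^{n'}(Ω)`, `𝕖[β] = [dα + (-1)^n β∧ε]` for any witness `α`
(`n' = n + 2`). -/
def eulerChar (d e : A →ₗ[ℝ] A) (P Q : ℤ → Submodule ℝ A) (n n' : ℤ)
    (E : HG d e P Q n →ₗ[ℝ] HOm d P n') : Prop :=
  ∀ (β : A) (hβ : β ∈ ZG d e P Q n) (α : A) (_ : α ∈ P (n + 1))
    (hz : d α + ((-1 : ℝ) ^ n) • e β ∈ ZOm d P n'),
    E (Submodule.Quotient.mk ⟨β, hβ⟩) =
      Submodule.Quotient.mk ⟨d α + ((-1 : ℝ) ^ n) • e β, hz⟩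

/-- `∂ : H^n(𝒦) → H^{n'}(G)`, `∂[ᾱ] = [dα]` (`n' = n + 1`). -/
def partialChar (d e : A →ₗ[ℝ] A) (P Q : ℤ → Submodule ℝ A) (n n' : ℤ)
    (pd : HKo d e P Q n →ₗ[ℝ] HG d e P Q n') : Prop :=
  ∀ (α : A) (hα : α ∈ ZKo d e P Q n) (hd : d α ∈ ZG d e P Q n'),
    pd (Submodule.Quotient.mk ⟨α, hα⟩) = Submodule.Quotient.mk ⟨d α, hd⟩

/-- `Pr : H^n(Ω) → H^{n'}(𝒦)` induced by the projection `Ω → 𝒦 = Ω/G` (`n' = n`). -/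
def prChar (d e : A →ₗ[ℝ] A) (P Q : ℤ → Submodule ℝ A) (n n' : ℤ)
    (pr : HOm d P n →ₗ[ℝ] HKo d e P Q n') : Prop :=
  ∀ (α : A) (hα : α ∈ ZOm d P n) (hα' : α ∈ ZKo d e P Q n'),
    pr (Submodule.Quotient.mk ⟨α, hα⟩) = Submodule.Quotient.mk ⟨α, hα'⟩

theorem neg_one_zpow_sub_two_mul (m k : ℤ) : (-1 : ℝ) ^ (m - 2 * k) = (-1) ^ m := by
  rw [zpow_sub₀ (by norm_num), zpow_mul]
  simp

theorem neg_one_zpow_sub_one (m : ℤ) : (-1 : ℝ) ^ (m - 1) = -(-1) ^ m := by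
  rw [zpow_sub_one₀ (by norm_num)]
  norm_num

theorem neg_one_zpow_smul_smul (m : ℤ) (x : A) : (-1 : ℝ) ^ m • (-1 : ℝ) ^ m • x = x := by
  rw [smul_smul, ← mul_zpow]
  simp

theorem nabla_apply_zero (d e : A →ₗ[ℝ] A) (m : ℤ) (ω : ℕ → A × A) :
    nabla d e m ω 0 = (d (ω 0).1 - (-1 : ℝ) ^ m • e (ω 0).2, d (ω 0).2) := by
  simp only [nabla, Dmap, D1, neg_one_zpow_sub_one, neg_one_zpow_sub_two_mul]
  ext <;> simp [sub_eq_add_neg]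

theorem nabla_apply_succ (d e : A →ₗ[ℝ] A) (m : ℤ) (ω : ℕ → A × A) (j : ℕ) :
    nabla d e m ω (j + 1) =
      (d (ω (j + 1)).1 - (-1 : ℝ) ^ m • (e (ω (j + 1)).2 + (ω j).2), d (ω (j + 1)).2) := by
  simp only [nabla, Dmap, D1, neg_one_zpow_sub_one, neg_one_zpow_sub_two_mul]
  ext <;> simp [smul_add]
  abel

theorem mem_Csub {d e : A →ₗ[ℝ] A} {P Q : ℤ → Submodule ℝ A} {m : ℤ} {ω : ℕ → A × A} :
    ω ∈ Csub d e P Q m ↔ ∀ j : ℕ,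
      (ω j).1 ∈ P (m - 2 * j) ∧ (ω j).2 ∈ Q (m - 2 * j - 1) ∧ d (ω j).2 ∈ Q (m - 2 * j) ∧
        d (ω j).1 - (-1 : ℝ) ^ m • e (ω j).2 ∈ P (m - 2 * j + 1) := by
  simp only [Csub, Ksub, D1, neg_one_zpow_sub_one, neg_one_zpow_sub_two_mul]
  simp [sub_eq_add_neg, and_assoc]

theorem mem_Om {d : A →ₗ[ℝ] A} {P : ℤ → Submodule ℝ A} {m : ℤ} {α : A} :
    α ∈ Om d P m ↔ α ∈ P m ∧ d α ∈ P (m + 1) := by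
  simp [Om]

theorem mem_Gsub {d e : A →ₗ[ℝ] A} {P Q : ℤ → Submodule ℝ A} {m : ℤ} {β : A} :
    β ∈ Gsub d e P Q m ↔ (β ∈ Q m ∧ d β ∈ Q (m + 1)) ∧
      ∃ γ ∈ P (m + 1), d γ + (-1 : ℝ) ^ m • e β ∈ P (m + 2) := by
  simp [Gsub]

theorem embL_zero (α : A) : embL α 0 = (α, 0) := by
  simp [embL]

theorem embL_succ (α : A) (j : ℕ) : embL α (j + 1) = 0 := by
  simp [embL]

theorem nabla_embL (d e : A →ₗ[ℝ] A) (m : ℤ) (α : A) : nabla d e m (embL α) = embL (d α) := by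
  funext j
  rcases j with _ | _ | j <;>
    simp [nabla_apply_zero, nabla_apply_succ, embL_zero, embL_succ]

theorem embL_injective : Function.Injective (embL : A →ₗ[ℝ] ℕ → A × A) := fun α β h => by
  simpa [embL_zero] using congrFun h 0

theorem embL_mem_Csub {d e : A →ₗ[ℝ] A} {P Q : ℤ → Submodule ℝ A} {m : ℤ} {α : A}
    (hα : α ∈ Om d P m) : embL α ∈ Csub d e P Q m := by
  rw [mem_Om] at hα
  rw [mem_Csub]
  rintro (_ | j)
  · simpa [embL_zero] using hα
  · simp [embL_succ]

theorem embL_mem_ZC {d e : A →ₗ[ℝ] A} {P Q : ℤ → Submodule ℝ A} {m : ℤ} {α : A}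
    (hα : α ∈ ZOm d P m) : embL α ∈ ZC d e P Q m := by
  refine ⟨embL_mem_Csub hα.1, ?_⟩
  change nabla d e m (embL α) = 0
  rw [nabla_embL, LinearMap.mem_ker.1 hα.2, map_zero]

theorem nabla_nabla {d e : A →ₗ[ℝ] A} (hd : d ∘ₗ d = 0) (hde : d ∘ₗ e = e ∘ₗ d) (m : ℤ)
    (ω : ℕ → A × A) : nabla d e m (nabla d e (m - 1) ω) = 0 := by
  have hd' (x : A) : d (d x) = 0 := LinearMap.congr_fun hd x
  have hde' (x : A) : d (e x) = e (d x) := LinearMap.congr_fun hde x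
  funext j
  rcases j with _ | _ | j
  · simp [nabla_apply_zero, neg_one_zpow_sub_one, hd', hde']
  all_goals
    simp [nabla_apply_zero, nabla_apply_succ, neg_one_zpow_sub_one, hd', hde']
    abel

theorem nabla_mem_Csub {d e : A →ₗ[ℝ] A} (hd : d ∘ₗ d = 0) (hde : d ∘ₗ e = e ∘ₗ d)
    {P Q : ℤ → Submodule ℝ A} (hQP : ∀ n, Q n ≤ P n) {m : ℤ} {ω : ℕ → A × A}
    (hω : ω ∈ Csub d e P Q (m - 1)) : nabla d e (m - 1) ω ∈ Csub d e P Q m := by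
  have hd' (x : A) : d (d x) = 0 := LinearMap.congr_fun hd x
  have hde' (x : A) : d (e x) = e (d x) := LinearMap.congr_fun hde x
  rw [mem_Csub] at hω ⊢
  rintro (_ | j)
  · obtain ⟨-, -, h3, h4⟩ := hω 0
    rw [show m - 1 - 2 * ((0 : ℕ) : ℤ) = m - 2 * ((0 : ℕ) : ℤ) - 1 by ring] at h3 h4
    rw [sub_add_cancel] at h4
    rw [nabla_apply_zero]
    exact ⟨h4, h3, by simp [hd'], by simp [neg_one_zpow_sub_one, hd', hde']⟩
  · obtain ⟨-, -, h3, h4⟩ := hω (j + 1)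
    obtain ⟨-, k2, k3, -⟩ := hω j
    rw [show m - 1 - 2 * ((j + 1 : ℕ) : ℤ) = m - 2 * ((j + 1 : ℕ) : ℤ) - 1 by ring] at h3 h4
    rw [sub_add_cancel] at h4
    rw [show m - 1 - 2 * (j : ℤ) - 1 = m - 2 * ((j + 1 : ℕ) : ℤ) by push_cast; ring] at k2
    rw [show m - 1 - 2 * (j : ℤ) = m - 2 * ((j + 1 : ℕ) : ℤ) + 1 by push_cast; ring] at k3
    rw [nabla_apply_succ]
    refine ⟨?_, h3, by simp [hd'], ?_⟩
    · rw [smul_add, ← sub_sub]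
      exact sub_mem h4 (Submodule.smul_mem _ _ (hQP _ k2))
    · simpa [neg_one_zpow_sub_one, hd', hde'] using
        Submodule.smul_mem _ ((-1 : ℝ) ^ m) (hQP _ k3)

/-- The element `(γ, β) ⊗ u^j` of `C`, for `β ∈ G` with witness `γ`. -/
theorem single_mem_Csub {d e : A →ₗ[ℝ] A} {P Q : ℤ → Submodule ℝ A} {m : ℤ} {j : ℕ} {β γ : A}
    (hβ : β ∈ Q (m - 2 * j - 1)) (hdβ : d β ∈ Q (m - 2 * j)) (hγ : γ ∈ P (m - 2 * j))
    (hγβ : d γ - (-1 : ℝ) ^ m • e β ∈ P (m - 2 * j + 1)) :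
    Pi.single j (γ, β) ∈ Csub d e P Q m := by
  rw [mem_Csub]
  intro i
  rcases eq_or_ne i j with rfl | hij
  · simpa using ⟨hγ, hβ, hdβ, hγβ⟩
  · simp [Pi.single_eq_of_ne hij]

/-- A cochain of `C` of `u`-degree at most `J` whose differential has `u`-degree `0` agrees, up to
a coboundary, with an element of `Ω ⊗ 1`. -/
theorem exists_eq_embL_add_nabla_of_bounded {d e : A →ₗ[ℝ] A} (hd : d ∘ₗ d = 0)
    (hde : d ∘ₗ e = e ∘ₗ d) {P Q : ℤ → Submodule ℝ A} (hQP : ∀ n, Q n ≤ P n)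
    (hOG : ∀ n : ℤ, Om d P n ≤ Gsub d e P Q n) {m : ℤ} (J : ℕ) {ω : ℕ → A × A}
    (hω : ω ∈ Csub d e P Q m) (hn : ∀ j, nabla d e m ω (j + 1) = 0) (hJ : ∀ j, J < j → ω j = 0) :
    ∃ α ∈ Om d P m, ∃ η ∈ Csub d e P Q (m - 1), ω = embL α + nabla d e (m - 1) η := by
  induction J generalizing ω with
  | zero =>
    have h0 : (ω 0).2 = 0 := by
      simpa [nabla_apply_succ, hJ 1 one_pos, zpow_ne_zero] using congrArg Prod.fst (hn 0)
    have hK := mem_Csub.1 hω 0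
    refine ⟨(ω 0).1, mem_Om.2 ⟨by simpa using hK.1, by simpa [h0] using hK.2.2.2⟩, 0, zero_mem _, ?_⟩
    funext j
    rcases j with _ | j
    · simp [embL_zero, ← h0]
    · simp [embL_succ, hJ]
  | succ J ih =>
    have h0 : (ω (J + 1)).2 = 0 := by
      simpa [nabla_apply_succ, hJ (J + 1 + 1) (by omega), zpow_ne_zero] using
        congrArg Prod.fst (hn (J + 1))
    have hK := mem_Csub.1 hω (J + 1)
    have hΩ : (ω (J + 1)).1 ∈ Om d P (m - 2 * ((J + 1 : ℕ) : ℤ)) :=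
      mem_Om.2 ⟨hK.1, by simpa [h0] using hK.2.2.2⟩
    obtain ⟨⟨hβ, hdβ⟩, γ, hγ, hγβ⟩ := mem_Gsub.1 (hOG _ hΩ)
    set η : ℕ → A × A := Pi.single J (γ, (ω (J + 1)).1) with hη_def
    have hη : η ∈ Csub d e P Q (m - 1) := by
      apply single_mem_Csub
      · convert hβ using 2
        push_cast; ring
      · convert hdβ using 2
        push_cast; ring
      · convert hγ using 2
        push_cast; ring
      · rw [neg_one_zpow_sub_two_mul] at hγβ
        convert hγβ using 2
        · push_cast; ring
        · rw [neg_one_zpow_sub_one, neg_smul, sub_neg_eq_add]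
    have hs := Submodule.smul_mem _ ((-1 : ℝ) ^ m) hη
    obtain ⟨α, hα, ζ, hζ, h⟩ := ih
      (ω := ω - nabla d e (m - 1) ((-1 : ℝ) ^ m • η))
      (sub_mem hω (nabla_mem_Csub hd hde hQP hs))
      (fun j => by rw [map_sub, nabla_nabla hd hde, sub_zero, hn]) (by
        rintro (_ | j) hj
        · omega
        rw [map_smul, Pi.sub_apply, Pi.smul_apply, nabla_apply_succ]
        rcases eq_or_ne j J with rfl | hne
        · ext <;> simp [hη_def, neg_one_zpow_sub_one, neg_one_zpow_smul_smul, h0]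
        · simp [hη_def, Pi.single_eq_of_ne hne, Pi.single_eq_of_ne (show j + 1 ≠ J by omega),
            hJ (j + 1) (by omega)])
    refine ⟨α, hα, ζ + (-1 : ℝ) ^ m • η, add_mem hζ hs, ?_⟩
    rw [map_add, ← add_assoc, ← h, sub_add_cancel]

theorem exists_eq_embL_add_nabla {d e : A →ₗ[ℝ] A} (hd : d ∘ₗ d = 0)
    (hde : d ∘ₗ e = e ∘ₗ d) {P Q : ℤ → Submodule ℝ A} (hQP : ∀ n, Q n ≤ P n)
    (hPneg : ∀ n : ℤ, n < 0 → P n = ⊥) (hQneg : ∀ n : ℤ, n < 0 → Q n = ⊥)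
    (hOG : ∀ n : ℤ, Om d P n ≤ Gsub d e P Q n) {m : ℤ} {ω : ℕ → A × A}
    (hω : ω ∈ Csub d e P Q m) (hn : ∀ j, nabla d e m ω (j + 1) = 0) :
    ∃ α ∈ Om d P m, ∃ η ∈ Csub d e P Q (m - 1), ω = embL α + nabla d e (m - 1) η := by
  refine exists_eq_embL_add_nabla_of_bounded hd hde hQP hOG m.toNat hω hn fun j hj => ?_
  obtain ⟨h1, h2, -⟩ := mem_Csub.1 hω j
  rw [hPneg _ (by omega), Submodule.mem_bot] at h1
  rw [hQneg _ (by omega), Submodule.mem_bot] at h2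
  exact Prod.ext h1 h2

/-- suppose `Ω^n ⊆ G^n` for every `n` (one always has `G ⊆ Ω`, so this
says `G = Ω` and the co-Gysin complex `𝒦 = Ω/G` vanishes; it models a free action).
Then for every `n` the map `H^n(Ω) → H^n(C)` induced by `π'`, namely
`[α] ↦ [(α,0)⊗1]`, is an isomorphism. -/
theorem statement_16 {A : Type*} [AddCommGroup A] [Module ℝ A]
    (d e : A →ₗ[ℝ] A) (hd : d ∘ₗ d = 0) (hde : d ∘ₗ e = e ∘ₗ d)
    (P Q : ℤ → Submodule ℝ A) (hQP : ∀ n, Q n ≤ P n)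
    (hPneg : ∀ n : ℤ, n < 0 → P n = ⊥) (hQneg : ∀ n : ℤ, n < 0 → Q n = ⊥)
    (hOG : ∀ n : ℤ, Om d P n ≤ Gsub d e P Q n)
    (n : ℤ)
    (piH : HOm d P n →ₗ[ℝ] HC d e P Q n)
    (hpiH : ∀ (α : A) (hα : α ∈ ZOm d P n) (h2 : embL α ∈ ZC d e P Q n),
      piH (Submodule.Quotient.mk ⟨α, hα⟩) = Submodule.Quotient.mk ⟨embL α, h2⟩) :
    Function.Bijective piH := by
  constructor
  · rw [injective_iff_map_eq_zero]
    intro x hx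
    obtain ⟨⟨α, hα⟩, rfl⟩ := Submodule.Quotient.mk_surjective _ x
    rw [hpiH α hα (embL_mem_ZC hα), Submodule.Quotient.mk_eq_zero] at hx
    obtain ⟨ω, hω, hωα⟩ := hx
    replace hωα : nabla d e (n - 1) ω = embL α := hωα
    obtain ⟨β, hβ, η, -, rfl⟩ := exists_eq_embL_add_nabla hd hde hQP hPneg hQneg hOG hω
      fun j => by rw [hωα, embL_succ]
    rw [map_add, nabla_nabla hd hde, add_zero, nabla_embL] at hωα
    rw [Submodule.Quotient.mk_eq_zero]
    exact ⟨β, hβ, embL_injective hωα⟩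
  · intro y
    obtain ⟨⟨ω, hω, hn⟩, rfl⟩ := Submodule.Quotient.mk_surjective _ y
    replace hn : nabla d e n ω = 0 := hn
    obtain ⟨α, hα, η, hη, rfl⟩ := exists_eq_embL_add_nabla hd hde hQP hPneg hQneg hOG hω
      fun j => by rw [hn, Pi.zero_apply]
    rw [map_add, nabla_nabla hd hde, add_zero, nabla_embL] at hn
    have hZ : α ∈ ZOm d P n := ⟨hα, embL_injective (hn.trans (map_zero _).symm)⟩
    refine ⟨Submodule.Quotient.mk ⟨α, hZ⟩, ?_⟩
    rw [hpiH α hZ (embL_mem_ZC hZ), Submodule.Quotient.eq]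
    refine ⟨-η, neg_mem hη, ?_⟩
    simp

end IG

end
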